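/- Let A ∈ M_n(ℂ) be such that its first n−1 rows are linearly independent, its n-th row is zero (i.e. e_n·e_n = 0), and in addition the first n−1 columns of A are linearly independent. Let d be a derivation of E(A) with matrix entries d_{ij}, and suppose d_{nn} = 0. Then d = 0. -/

import Mathlib

open Matrix Polynomial Finset

/-- The multiplication of the evolution algebra `E(A)` on `ℂ^n` associated to the
matrix `A`: it is the unique commutative bilinear multiplication with
`e i · e j = 0` for `i ≠ j` and `e i · e i = ∑ k, A i k • e k`, where `e i = Pi.single i 1`
is the standard (natural) basis. -/
noncomputable def evolMul {n : ℕ} (A : Matrix (Fin n) (Fin n) ℂ) (u v : Fin n → ℂ) : Fin n → ℂ :=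
  fun k => ∑ i, u i * v i * A i k

/-- A linear map `d : E(A) → E(A)` is a derivation if `d (u·v) = d u · v + u · d v`. -/
def IsEvolDerivation {n : ℕ} (A : Matrix (Fin n) (Fin n) ℂ)
    (d : (Fin n → ℂ) →ₗ[ℂ] (Fin n → ℂ)) : Prop :=
  ∀ u v : Fin n → ℂ, d (evolMul A u v) = evolMul A (d u) v + evolMul A u (d v)

lemma evolMul_single_right {n : ℕ} (A : Matrix (Fin n) (Fin n) ℂ) (u : Fin n → ℂ) (j : Fin n) :
    evolMul A u (Pi.single j 1) = u j • A j := by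
  ext k
  simp [evolMul, Pi.single_apply]

lemma evolMul_comm {n : ℕ} (A : Matrix (Fin n) (Fin n) ℂ) (u v : Fin n → ℂ) :
    evolMul A u v = evolMul A v u := by
  ext k
  simp only [evolMul, mul_comm (u _)]

namespace IsEvolDerivation

variable {n : ℕ} {A : Matrix (Fin n) (Fin n) ℂ} {d : (Fin n → ℂ) →ₗ[ℂ] (Fin n → ℂ)}

lemma smul_row_add_smul_row (hd : IsEvolDerivation A d) {i j : Fin n} (hij : i ≠ j) :
    d (Pi.single i 1) j • A j + d (Pi.single j 1) i • A i = 0 := by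
  have h := hd (Pi.single i 1) (Pi.single j 1)
  rw [evolMul_comm A (Pi.single i 1) (d _)] at h
  simp only [evolMul_single_right, Pi.single_eq_of_ne hij.symm, zero_smul, map_zero] at h
  exact h.symm

lemma sum_row_mul (hd : IsEvolDerivation A d) (i k : Fin n) :
    ∑ j, A i j * d (Pi.single j 1) k = 2 * d (Pi.single i 1) i * A i k := by
  have h := congrFun (hd (Pi.single i 1) (Pi.single i 1)) k
  rw [evolMul_comm A (Pi.single i 1) (d _)] at h
  simp only [evolMul_single_right, Pi.single_eq_same, one_smul] at h
  rw [LinearMap.pi_apply_eq_sum_univ d (A i)] at h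
  have hs (j : Fin n) : (fun l => if j = l then (1 : ℂ) else 0) = Pi.single j 1 := by
    ext l
    simp [Pi.single_apply, eq_comm]
  simp only [hs, Finset.sum_apply, Pi.smul_apply, Pi.add_apply, smul_eq_mul] at h
  rw [h]
  ring

end IsEvolDerivation

/-- A family on a finite type in which every member is twice another member vanishes. -/
lemma eq_zero_of_forall_exists_eq_two_mul {ι : Type*} [Finite ι] (f : ι → ℂ)
    (h : ∀ k, ∃ i, f k = 2 * f i) (k : ι) : f k = 0 := by
  by_contra hk
  obtain ⟨m, hm, hmin⟩ := Set.exists_min_image {i | f i ≠ 0} (fun i => ‖f i‖)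
    (Set.toFinite _) ⟨k, hk⟩
  obtain ⟨i, hi⟩ := h m
  have hi0 : f i ≠ 0 := fun h0 => hm (by rw [hi, h0, mul_zero])
  have hle : ‖f m‖ ≤ ‖f i‖ := hmin i hi0
  rw [hi, norm_mul, Complex.norm_ofNat] at hle
  linarith [norm_pos_iff.mpr hi0]

/-- Suppose the first `n-1` rows of `A` are linearly independent, the `n`-th row is zero
(i.e. `eₙ·eₙ = 0`), and in addition the first `n-1` columns of `A` are linearly
independent.  If a derivation `d` of `E(A)` satisfies `dₙₙ = 0`, then `d = 0`. -/
theorem derivation_eq_zero_of_zero_last_row_indep_columns (n : ℕ) (hn : 2 ≤ n)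
    (A : Matrix (Fin n) (Fin n) ℂ)
    (hrows : LinearIndependent ℂ (fun i : Fin (n - 1) => A (Fin.castLE (Nat.sub_le n 1) i)))
    (hzero : A (⟨n - 1, by omega⟩ : Fin n) = 0)
    (hcols : LinearIndependent ℂ
      (fun j : Fin (n - 1) => Aᵀ (Fin.castLE (Nat.sub_le n 1) j)))
    (d : (Fin n → ℂ) →ₗ[ℂ] (Fin n → ℂ)) (hd : IsEvolDerivation A d)
    (hdnn : d (Pi.single (⟨n - 1, by omega⟩ : Fin n) 1) (⟨n - 1, by omega⟩ : Fin n) = 0) :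
    d = 0 := by
  obtain ⟨m, rfl⟩ : ∃ m, n = m + 1 := ⟨n - 1, by omega⟩
  change LinearIndependent ℂ (fun i : Fin m => A i.castSucc) at hrows
  change A (Fin.last m) = 0 at hzero
  change LinearIndependent ℂ (fun j : Fin m => Aᵀ j.castSucc) at hcols
  change d (Pi.single (Fin.last m) 1) (Fin.last m) = 0 at hdnn
  have hoff (i j : Fin m) (hij : i ≠ j) : d (Pi.single i.castSucc 1) j.castSucc = 0 := by
    have h := hd.smul_row_add_smul_row ((Fin.castSucc_injective m).ne hij)
    have hpair := hrows.comp ![j, i] (by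
      intro a b hab
      fin_cases a <;> fin_cases b <;> simp_all [eq_comm])
    exact (Fintype.linearIndependent_iff.mp hpair
      ![d (Pi.single i.castSucc 1) j.castSucc, d (Pi.single j.castSucc 1) i.castSucc]
      (by simpa [Fin.sum_univ_two] using h) 0)
  have hlast : d (Pi.single (Fin.last m) 1) = 0 := by
    ext j
    refine Fin.lastCases hdnn (fun j => ?_) j
    have h := hd.smul_row_add_smul_row (Fin.castSucc_lt_last j).ne'
    rw [hzero, smul_zero, add_zero] at h
    exact (smul_eq_zero.mp h).resolve_right (hrows.ne_zero j)
  have hdiag : ∀ k : Fin m, d (Pi.single k.castSucc 1) k.castSucc = 0 := by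
    refine eq_zero_of_forall_exists_eq_two_mul _ fun k => ?_
    obtain ⟨i, hi⟩ := Function.ne_iff.mp (hcols.ne_zero k)
    change A i k.castSucc ≠ 0 at hi
    induction i using Fin.lastCases with
    | last => exact absurd (congrFun hzero _) hi
    | cast i =>
      refine ⟨i, ?_⟩
      have h := hd.sum_row_mul i.castSucc k.castSucc
      rw [Fin.sum_univ_castSucc, hlast, Pi.zero_apply, mul_zero, add_zero,
        Finset.sum_eq_single k (fun j _ hj => by rw [hoff j k hj, mul_zero]) (by simp),
        mul_comm] at h
      exact mul_right_cancel₀ hi h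
  have hcol : ∀ k : Fin m, d (Pi.single k.castSucc 1) (Fin.last m) = 0 := by
    refine Fintype.linearIndependent_iff.mp hcols _ ?_
    ext i
    have hi : d (Pi.single i 1) i = 0 := Fin.lastCases hdnn hdiag i
    have h := hd.sum_row_mul i (Fin.last m)
    rw [hi, mul_zero, zero_mul, Fin.sum_univ_castSucc, hlast, Pi.zero_apply, mul_zero,
      add_zero] at h
    simpa [mul_comm] using h
  refine (Pi.basisFun ℂ (Fin (m + 1))).ext fun i => ?_
  rw [Pi.basisFun_apply, LinearMap.zero_apply]
  induction i using Fin.lastCases with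
  | last => exact hlast
  | cast i =>
    ext j
    induction j using Fin.lastCases with
    | last => exact hcol i
    | cast j =>
      rcases eq_or_ne i j with rfl | hij
      · exact hdiag i
      · exact hoff i j hij
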